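/- Let A be a C*-algebra (not necessarily unital), B a closed star-subalgebra of A, and E : A → A a conditional expectation from A onto B. For each natural number n, let E_n denote the entrywise application of E to n×n matrices over A, acting on the C*-algebra of n×n matrices over A (equipped with its unique C*-norm). Then the following are equivalent: (i) E has finite probabilistic index, i.e., there exists γ ≥ 1 such that a ≤ γ•E(a) for every positive a ∈ A; (ii) E has finite completely positive index, i.e., there exists γ ≥ 1 such that for every n and every positive n×n matrix m over A one has m ≤ γ•E_n(m). -/

import Mathlib

open scoped Matrix

open scoped ComplexOrder InnerProductSpace

/-- The state space. -/
def FKStates (U : Type*) [CStarAlgebra U] [PartialOrder U] : Set (U → ℂ) :=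
  {f | (∀ a b, f (a + b) = f a + f b) ∧ (∀ (c : ℂ) a, f (c • a) = c * f a) ∧
    (∀ a, 0 ≤ a → 0 ≤ f a) ∧ f 1 = 1}

section states
variable {U : Type*} [CStarAlgebra U] [PartialOrder U] [StarOrderedRing U]

/-- A state as a positive map. -/
noncomputable def FKStates.toPos {f : U → ℂ} (hf : f ∈ FKStates U) : U →ₚ[ℂ] ℂ :=
  PositiveLinearMap.mk₀ { toFun := f, map_add' := hf.1, map_smul' := hf.2.1 } hf.2.2.1

theorem FKStates.toPos_apply {f : U → ℂ} (hf : f ∈ FKStates U) (a : U) :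
    FKStates.toPos hf a = f a := rfl

theorem fk_state_norm_le {f : U → ℂ} (hf : f ∈ FKStates U) (a : U) : ‖f a‖ ≤ 4 * ‖a‖ := by
  obtain ⟨y, hy_nonneg, hy_norm, hy⟩ := CStarAlgebra.exists_sum_four_nonneg a
  change ‖FKStates.toPos hf a‖ ≤ _
  conv_lhs => rw [hy]
  simp only [map_sum, map_smul]
  apply norm_sum_le _ _ |>.trans
  simp only [norm_smul, norm_pow, Complex.norm_I, one_pow, one_mul]
  apply Finset.sum_le_sum (g := fun _ ↦ ‖a‖) (fun i _ ↦ ?_) |>.trans <| by simp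
  have := (FKStates.toPos hf).norm_apply_le_of_nonneg _ (hy_nonneg i)
  rw [FKStates.toPos_apply hf 1, hf.2.2.2] at this
  simp only [norm_one, one_mul] at this
  exact this.trans (hy_norm i)

theorem fk_states_compact : IsCompact (FKStates U) := by
  have hc : IsClosed (FKStates U) := by
    have he (a : U) : Continuous (fun f : U → ℂ => f a) := continuous_apply a
    have hS : FKStates U = (⋂ a, ⋂ b, {f : U → ℂ | f (a + b) = f a + f b}) ∩
        ((⋂ c : ℂ, ⋂ a, {f : U → ℂ | f (c • a) = c * f a}) ∩
        ((⋂ a, ⋂ _ : 0 ≤ a, {f : U → ℂ | 0 ≤ f a}) ∩ {f : U → ℂ | f 1 = 1})) := by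
      ext f; simp [FKStates]
    rw [hS]
    refine IsClosed.inter ?_ (IsClosed.inter ?_ (IsClosed.inter ?_ ?_))
    · exact isClosed_iInter fun a => isClosed_iInter fun b =>
        isClosed_eq (he _) ((he _).add (he _))
    · exact isClosed_iInter fun a => isClosed_iInter fun b =>
        isClosed_eq (he _) (continuous_const.mul (he _))
    · exact isClosed_iInter fun a => isClosed_iInter fun b =>
        isClosed_le continuous_const (he _)
    · exact isClosed_eq (he _) continuous_const
  have hK : IsCompact (Set.pi Set.univ (fun a : U => Metric.closedBall (0 : ℂ) (4 * ‖a‖))) :=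
    isCompact_univ_pi fun a => isCompact_closedBall _ _
  refine hK.of_isClosed_subset hc ?_
  intro f hf a _
  simpa using fk_state_norm_le hf a

theorem fk_exists_state (c : U) (hc : IsSelfAdjoint c) (hn : ¬ 0 ≤ c) :
    ∃ f ∈ FKStates U, (f c).re < 0 := by
  let C : ProperCone ℝ U :=
    { carrier := {a | 0 ≤ a}
      add_mem' := fun ha hb => add_nonneg ha hb
      zero_mem' := le_refl _
      smul_mem' := fun r a ha => smul_nonneg r.2 ha
      isClosed' := CStarAlgebra.isClosed_nonneg }
  obtain ⟨g, hg, hgc⟩ := C.hyperplane_separation_point (x₀ := c) hn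
  replace hg : ∀ a : U, 0 ≤ a → 0 ≤ g a := fun a ha => hg a ha
  let gs : Module.Dual ℝ U :=
    { toFun := fun a => (g a + g (star a)) / 2
      map_add' := fun a b => by simp only [star_add, map_add]; ring
      map_smul' := fun r a => by
        simp only [star_smul, star_trivial, map_smul, smul_eq_mul, RingHom.id_apply]; ring }
  let φ : Module.Dual ℂ U := gs.extendRCLike
  have hφ (a : U) (ha : IsSelfAdjoint a) : φ a = (g a : ℂ) := by
    have h1 : gs a = g a := by simp [gs, ha.star_eq]
    have h2 : gs ((RCLike.I : ℂ) • a) = 0 := by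
      simp [gs, ha.star_eq]
    rw [Module.Dual.extendRCLike_apply, h1, h2]; simp
  have hg1 : 0 < g 1 := by
    rcases (hg 1 zero_le_one).lt_or_eq with h | h
    · exact h
    · exfalso
      have h3 := hg _ (sub_nonneg.2 hc.neg_algebraMap_norm_le_self)
      rw [Algebra.algebraMap_eq_smul_one, map_sub, map_neg, map_smul, ← h] at h3
      simp at h3; linarith
  refine ⟨fun a => (g 1 : ℂ)⁻¹ * φ a, ⟨?_, ?_, ?_, ?_⟩, ?_⟩
  · intro a b; simp [mul_add]
  · intro a b; simp; ring
  · intro a ha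
    dsimp only
    rw [hφ a (.of_nonneg ha)]
    have := hg a ha
    norm_cast; positivity
  · dsimp only
    rw [hφ 1 (.one _), inv_mul_cancel₀]; exact_mod_cast hg1.ne'
  · dsimp only
    rw [hφ c hc]
    norm_cast
    exact mul_neg_of_pos_of_neg (by positivity) hgc

theorem fk_exists_pure (c : U) (hc : IsSelfAdjoint c) (hn : ¬ 0 ≤ c) :
    ∃ f ∈ (FKStates U).extremePoints ℝ, (f c).re < 0 := by
  obtain ⟨f, hf, hfc⟩ := fk_exists_state c hc hn
  let l : StrongDual ℝ (U → ℂ) :=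
    -(Complex.reCLM.comp (ContinuousLinearMap.proj (R := ℝ) (φ := fun _ : U => ℂ) c))
  have hl (f : U → ℂ) : l f = - (f c).re := rfl
  have hex : IsExposed ℝ (FKStates U) (l.toExposed (FKStates U)) :=
    ContinuousLinearMap.toExposed.isExposed
  have hcomp := hex.isCompact fk_states_compact
  obtain ⟨f₀, hf₀, hmax⟩ := fk_states_compact.exists_isMaxOn ⟨f, hf⟩ l.continuous.continuousOn
  obtain ⟨e, he⟩ := hcomp.extremePoints_nonempty ⟨f₀, hf₀, fun y hy => hmax hy⟩
  refine ⟨e, hex.isExtreme.extremePoints_subset_extremePoints he, ?_⟩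
  have h1 := he.1.2 f hf
  rw [hl, hl] at h1
  linarith

end states

section irr

theorem fk_mul_apply {H : Type*} [NormedAddCommGroup H] [InnerProductSpace ℂ H]
    (S T : H →L[ℂ] H) (x : H) : (S * T) x = S (T x) := rfl

theorem fk_proj_comm {H : Type*} [NormedAddCommGroup H] [InnerProductSpace ℂ H] [CompleteSpace H]
    (K : Submodule ℂ H) [K.HasOrthogonalProjection] (S : H →L[ℂ] H)
    (h1 : ∀ x ∈ K, S x ∈ K) (h2 : ∀ x ∈ K, (star S) x ∈ K) :
    K.starProjection * S = S * K.starProjection := by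
  ext x
  simp only [fk_mul_apply]
  refine Submodule.eq_starProjection_of_mem_orthogonal (h1 _ (K.starProjection_apply_mem x)) ?_
  rw [← map_sub]
  intro y hy
  rw [← ContinuousLinearMap.adjoint_inner_left]
  exact K.sub_starProjection_mem_orthogonal x _ (h2 y hy)

universe u

theorem fk_pure_scalar {U : Type u} [CStarAlgebra U] [PartialOrder U] [StarOrderedRing U]
    {f : U → ℂ} (hf : f ∈ (FKStates U).extremePoints ℝ)
    {H : Type*} [NormedAddCommGroup H] [InnerProductSpace ℂ H] [CompleteSpace H]
    (p : U →⋆ₐ[ℂ] (H →L[ℂ] H)) (w : H) (hw : ∀ a, ⟪w, p a w⟫_ℂ = f a)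
    (hd : Dense (Set.range fun a => p a w)) (T : H →L[ℂ] H) (hT : IsSelfAdjoint T)
    (hc : ∀ a, T * p a = p a * T) : ∃ z : ℂ, T = z • 1 := by
  have hw1 : ⟪w, w⟫_ℂ = 1 := by
    have := hw 1
    rw [hf.1.2.2.2] at this
    simpa using this
  set z : ℂ := ⟪w, T w⟫_ℂ with hz
  have hzr : star z = z := by
    rw [hz, Complex.star_def, inner_conj_symm]
    conv_rhs => rw [← hT.adjoint_eq]
    rw [ContinuousLinearMap.adjoint_inner_right]
  set T' : H →L[ℂ] H := T - z • 1 with hT'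
  have hT's : IsSelfAdjoint T' := by
    refine hT.sub ?_
    rw [IsSelfAdjoint, star_smul, hzr, star_one]
  have hT'c : ∀ a, T' * p a = p a * T' := fun a => by
    rw [hT', sub_mul, mul_sub, hc a]; simp
  have hT'w : ⟪w, T' w⟫_ℂ = 0 := by
    rw [hT', ContinuousLinearMap.sub_apply, ContinuousLinearMap.smul_apply, ContinuousLinearMap.one_apply,
      inner_sub_right, inner_smul_right, hw1, ← hz, mul_one, sub_self]
  set t : ℝ := (‖T'‖ + 1)⁻¹ with ht
  have ht0 : 0 < t := by positivity
  have key (s : ℝ) (hs : |s| ≤ t) :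
      (fun a => f a + s * ⟪w, T' (p a w)⟫_ℂ) ∈ FKStates U := by
    refine ⟨?_, ?_, ?_, ?_⟩
    · intro a b; simp [hf.1.1, inner_add_right]; ring
    · intro c a; simp [hf.1.2.1, inner_smul_right]; ring
    · intro a ha
      obtain ⟨b, rfl⟩ := CStarAlgebra.nonneg_iff_eq_star_mul_self.1 ha
      dsimp only
      have e1 : f (star b * b) = ((‖p b w‖ ^ 2 : ℝ) : ℂ) := by
        rw [← hw, map_mul, map_star, fk_mul_apply,
          ContinuousLinearMap.star_eq_adjoint, ContinuousLinearMap.adjoint_inner_right,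
          inner_self_eq_norm_sq_to_K]
        simp
      have e2 : ⟪w, T' (p (star b * b) w)⟫_ℂ = ⟪p b w, T' (p b w)⟫_ℂ := by
        have : T' (p (star b * b) w) = p (star b) (T' (p b w)) := by
          rw [map_mul]
          exact congrArg (fun S : H →L[ℂ] H => S (p b w)) (hT'c (star b))
        rw [this, map_star, ContinuousLinearMap.star_eq_adjoint,
          ContinuousLinearMap.adjoint_inner_right]
      set x := p b w
      have e3 : ((⟪x, T' x⟫_ℂ).re : ℂ) = ⟪x, T' x⟫_ℂ := by
        apply Complex.conj_eq_iff_re.1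
        rw [inner_conj_symm]
        conv_rhs => rw [← hT's.adjoint_eq]
        rw [ContinuousLinearMap.adjoint_inner_right]
      rw [e1, e2, ← e3]
      norm_cast
      have h1 : |(⟪x, T' x⟫_ℂ).re| ≤ ‖T'‖ * ‖x‖ ^ 2 := by
        refine (Complex.abs_re_le_norm _).trans ((norm_inner_le_norm _ _).trans ?_)
        have := T'.le_opNorm x
        nlinarith [norm_nonneg x]
      have h2 : |s * (⟪x, T' x⟫_ℂ).re| ≤ ‖x‖ ^ 2 := by
        rw [abs_mul]
        have h3 : t * ‖T'‖ ≤ 1 := by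
          rw [ht, inv_mul_le_iff₀ (by positivity)]; linarith
        calc |s| * |(⟪x, T' x⟫_ℂ).re| ≤ t * (‖T'‖ * ‖x‖ ^ 2) := by gcongr
          _ = (t * ‖T'‖) * ‖x‖ ^ 2 := by ring
          _ ≤ 1 * ‖x‖ ^ 2 := by gcongr
          _ = _ := one_mul _
      linarith [neg_abs_le (s * (⟪x, T' x⟫_ℂ).re)]
    · simp [hf.1.2.2.2, hT'w]
  have hplus := key t (by rw [abs_of_pos ht0])
  have hminus := key (-t) (by rw [abs_neg, abs_of_pos ht0])
  have hseg : f ∈ openSegment ℝ (fun a => f a + (t : ℝ) * ⟪w, T' (p a w)⟫_ℂ)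
      (fun a => f a + ((-t : ℝ) : ℂ) * ⟪w, T' (p a w)⟫_ℂ) := by
    refine ⟨1/2, 1/2, by norm_num, by norm_num, by norm_num, ?_⟩
    ext a
    simp
    ring
  have heq := hf.2 hplus hminus hseg
  have h0 : ∀ a, ⟪w, T' (p a w)⟫_ℂ = 0 := fun a => by
    have := congrFun heq a
    simp at this
    rcases this with h | h
    · exact absurd h ht0.ne'
    · exact h
  have h1 : T' w = 0 := by
    refine hd.eq_zero_of_inner_left (𝕜 := ℂ) ?_
    rintro _ ⟨a, rfl⟩
    dsimp only
    rw [← hT's.adjoint_eq, ContinuousLinearMap.adjoint_inner_left, h0]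
  have h2 : T' = 0 := by
    refine ContinuousLinearMap.ext_on (hd.mono Submodule.subset_span) ?_
    rintro _ ⟨a, rfl⟩
    have := congrArg (fun S : H →L[ℂ] H => S w) (hT'c a)
    simpa [h1] using this
  exact ⟨z, sub_eq_zero.1 h2⟩

theorem fk_pure_scalar' {U : Type u} [CStarAlgebra U] [PartialOrder U] [StarOrderedRing U]
    {f : U → ℂ} (hf : f ∈ (FKStates U).extremePoints ℝ)
    {H : Type*} [NormedAddCommGroup H] [InnerProductSpace ℂ H] [CompleteSpace H]
    (p : U →⋆ₐ[ℂ] (H →L[ℂ] H)) (w : H) (hw : ∀ a, ⟪w, p a w⟫_ℂ = f a)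
    (hd : Dense (Set.range fun a => p a w)) (T : H →L[ℂ] H)
    (hc : ∀ a, T * p a = p a * T) : ∃ z : ℂ, T = z • 1 := by
  have hcs : ∀ a, star T * p a = p a * star T := fun a => by
    have := congrArg star (hc (star a))
    simpa [map_star] using this.symm
  obtain ⟨z₁, h₁⟩ := fk_pure_scalar hf p w hw hd (T + star T) (IsSelfAdjoint.add_star_self T)
    (fun a => by rw [add_mul, mul_add, hc, hcs])
  obtain ⟨z₂, h₂⟩ := fk_pure_scalar hf p w hw hd (Complex.I • (T - star T))
    (by
      rw [IsSelfAdjoint, star_smul, star_sub, star_star, Complex.star_def, Complex.conj_I,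
        neg_smul, ← smul_neg, neg_sub])
    (fun a => by rw [smul_mul_assoc, mul_smul_comm, sub_mul, mul_sub, hc, hcs])
  refine ⟨(1/2) * (z₁ - Complex.I * z₂), ?_⟩
  have h3 : T - star T = (-Complex.I * z₂) • 1 := by
    rw [mul_smul, ← h₂, smul_smul]; simp
  have h4 : (2 : ℂ) • T = (z₁ + -Complex.I * z₂) • 1 := by
    rw [add_smul, ← h₁, ← h3, two_smul]; abel
  have h5 : T = (1/2 : ℂ) • ((2 : ℂ) • T) := by rw [smul_smul]; norm_num
  rw [h5, h4, smul_smul]; congr 1; ring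

theorem fk_exists_irrep_unital {U : Type u} [CStarAlgebra U] [PartialOrder U] [StarOrderedRing U]
    (c : U) (hc : IsSelfAdjoint c) (hn : ¬ 0 ≤ c) :
    ∃ (H : Type u) (_ : NormedAddCommGroup H) (_ : InnerProductSpace ℂ H) (_ : CompleteSpace H)
      (p : U →⋆ₐ[ℂ] (H →L[ℂ] H)),
      (∀ T : H →L[ℂ] H, (∀ a, T * p a = p a * T) → ∃ z : ℂ, T = z • 1) ∧
      ∃ w : H, (⟪w, p c w⟫_ℂ).re < 0 := by
  obtain ⟨f, hf, hfc⟩ := fk_exists_pure c hc hn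
  let φ := FKStates.toPos hf.1
  let w : φ.GNS := (φ.toPreGNS 1 : φ.PreGNS)
  have hpw (a : U) : φ.gnsStarAlgHom a w = ((φ.toPreGNS a : φ.PreGNS) : φ.GNS) := by
    change φ.gnsNonUnitalStarAlgHom a w = _
    rw [PositiveLinearMap.gnsNonUnitalStarAlgHom_apply_coe]
    simp
  have hw (a : U) : ⟪w, φ.gnsStarAlgHom a w⟫_ℂ = f a := by
    rw [hpw, UniformSpace.Completion.inner_coe, PositiveLinearMap.preGNS_inner_def]
    simp [φ, FKStates.toPos_apply]
  have hd : Dense (Set.range fun a => φ.gnsStarAlgHom a w) := by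
    have : (Set.range fun a => φ.gnsStarAlgHom a w) =
        Set.range ((↑) : φ.PreGNS → φ.GNS) := by
      ext x
      constructor
      · rintro ⟨a, rfl⟩; exact ⟨_, (hpw a).symm⟩
      · rintro ⟨a, rfl⟩; exact ⟨φ.ofPreGNS a, hpw _⟩
    rw [this]
    exact UniformSpace.Completion.denseRange_coe
  refine ⟨φ.GNS, inferInstance, inferInstance, inferInstance, φ.gnsStarAlgHom, ?_, w, ?_⟩
  · exact fun T hT => fk_pure_scalar' hf φ.gnsStarAlgHom w hw hd T hT
  · rw [hw]; exact hfc

theorem fk_exists_irrep {A : Type u} [NonUnitalCStarAlgebra A] [PartialOrder A]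
    [StarOrderedRing A] (c : A) (hc : IsSelfAdjoint c) (hn : ¬ 0 ≤ c) :
    ∃ (H : Type u) (_ : NormedAddCommGroup H) (_ : InnerProductSpace ℂ H) (_ : CompleteSpace H)
      (p : A →⋆ₙₐ[ℂ] (H →L[ℂ] H)),
      (∀ T : H →L[ℂ] H, (∀ a, T * p a = p a * T) → ∃ z : ℂ, T = z • 1) ∧
      (∀ x : H, (∀ a, p a x = 0) → x = 0) ∧
      ∃ w : H, (⟪w, p c w⟫_ℂ).re < 0 := by
  obtain ⟨H, i1, i2, i3, P, hirr, w, hw⟩ := fk_exists_irrep_unital (c : Unitization ℂ A)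
    (hc.inr ℂ) (by rwa [Unitization.inr_nonneg_iff])
  let p : A →⋆ₙₐ[ℂ] (H →L[ℂ] H) :=
    (P : Unitization ℂ A →⋆ₙₐ[ℂ] (H →L[ℂ] H)).comp (Unitization.inrNonUnitalStarAlgHom ℂ A)
  have hp (a : A) : p a = P (a : Unitization ℂ A) := rfl
  have hmul (a : A) (v : Unitization ℂ A) : ∃ b : A, (a : Unitization ℂ A) * v = b := by
    refine ⟨((a : Unitization ℂ A) * v).snd, ?_⟩
    ext <;> simp
  have hnd : ∀ x : H, (∀ a, p a x = 0) → x = 0 := by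
    let N : Submodule ℂ H := ⨅ a : A, LinearMap.ker (p a : H →ₗ[ℂ] H)
    have hN (x : H) : x ∈ N ↔ ∀ a, p a x = 0 := by simp [N]
    have hNc : IsClosed (N : Set H) := by
      have : (N : Set H) = ⋂ a : A, {x | p a x = 0} := by
        ext x; simp [hN]
      rw [this]
      exact isClosed_iInter fun a => isClosed_eq (p a).continuous continuous_const
    have : CompleteSpace N := hNc.completeSpace_coe
    have hinv (v : Unitization ℂ A) : ∀ x ∈ N, P v x ∈ N := by
      intro x hx
      rw [hN] at hx ⊢
      intro a
      obtain ⟨b, hb⟩ := hmul a v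
      rw [hp, ← fk_mul_apply, ← map_mul, hb]
      exact hx b
    obtain ⟨z, hz⟩ := hirr N.starProjection (fun v =>
      fk_proj_comm N (P v) (hinv v) (by rw [← map_star]; exact hinv _))
    intro x hx
    have h1 : N.starProjection x = x :=
      Submodule.starProjection_eq_self_iff.2 ((hN x).2 hx)
    by_contra hx0
    have hz1 : z ≠ 0 := by
      rintro rfl
      rw [hz] at h1; simp at h1; exact hx0 h1.symm
    have hall : w ∈ N := by
      have h2 : N.starProjection (z⁻¹ • w) = w := by
        rw [hz]; simp [smul_smul, hz1]
      rw [← h2]; exact N.starProjection_apply_mem _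
    have := (hN w).1 hall c
    rw [hp] at this
    rw [this] at hw
    simp at hw
  refine ⟨H, i1, i2, i3, p, ?_, hnd, w, hw⟩
  intro T hT
  refine hirr T fun v => ?_
  rw [← sub_eq_zero]
  ext x
  refine hnd _ fun a => ?_
  obtain ⟨b, hb⟩ := hmul a v
  have h1 : p a * (T * P v - P v * T) = 0 := by
    rw [mul_sub, ← mul_assoc, ← hT, mul_assoc, hp, ← mul_assoc _ (P v), ← map_mul, hb, ← hp, hT,
      sub_self]
  exact congrArg (fun S : H →L[ℂ] H => S x) h1

end irr

section density

variable {H : Type*} [NormedAddCommGroup H] [InnerProductSpace ℂ H] [CompleteSpace H]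
  {A : Type*} [NonUnitalCStarAlgebra A]

/-- Finite direct sum. -/
abbrev FKG (ι : Type*) (H : Type*) := PiLp 2 (fun _ : ι => H)

/-- Diagonal operator on the finite direct sum. -/
noncomputable def fkDiag (ι : Type*) [Fintype ι] (T : H →L[ℂ] H) :
    PiLp 2 (fun _ : ι => H) →L[ℂ] PiLp 2 (fun _ : ι => H) :=
  ((PiLp.continuousLinearEquiv 2 ℂ (fun _ : ι => H)).symm :
      (ι → H) →L[ℂ] PiLp 2 (fun _ : ι => H)) ∘L
    (ContinuousLinearMap.pi fun i => T ∘L PiLp.proj 2 (fun _ : ι => H) i)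

theorem fkDiag_apply {ι : Type*} [Fintype ι] (T : H →L[ℂ] H) (x : PiLp 2 (fun _ : ι => H))
    (i : ι) : fkDiag ι T x i = T (x i) := rfl

theorem fkDiag_star {ι : Type*} [Fintype ι] (T : H →L[ℂ] H) :
    star (fkDiag ι T) = fkDiag ι (star T) := by
  symm
  refine (ContinuousLinearMap.eq_adjoint_iff (fkDiag ι (star T)) (fkDiag ι T)).2 ?_
  intro x y
  simp only [PiLp.inner_apply, fkDiag_apply, ContinuousLinearMap.star_eq_adjoint,
    ContinuousLinearMap.adjoint_inner_left]

theorem fk_density (p : A →⋆ₙₐ[ℂ] (H →L[ℂ] H))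
    (hirr : ∀ T : H →L[ℂ] H, (∀ a, T * p a = p a * T) → ∃ z : ℂ, T = z • 1)
    (hnd : ∀ x : H, (∀ a, p a x = 0) → x = 0)
    {ι : Type*} [Fintype ι] (v y : ι → H) (hy : ∀ a, ∑ i, ⟪y i, p a (v i)⟫_ℂ = 0)
    (T : H →L[ℂ] H) : ∑ i, ⟪y i, T (v i)⟫_ℂ = 0 := by
  classical
  let V : FKG ι H := WithLp.toLp 2 v
  let Y : FKG ι H := WithLp.toLp 2 y
  let L : A →ₗ[ℂ] FKG ι H :=
    { toFun := fun a => fkDiag ι (p a) V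
      map_add' := fun a b => by ext i; simp [fkDiag_apply]
      map_smul' := fun c a => by ext i; simp [fkDiag_apply] }
  let M : Submodule ℂ (FKG ι H) := (LinearMap.range L).topologicalClosure
  have hMc : IsClosed (M : Set (FKG ι H)) := Submodule.isClosed_topologicalClosure _
  have : CompleteSpace M := hMc.completeSpace_coe
  have hLM (a : A) : fkDiag ι (p a) V ∈ M :=
    Submodule.le_topologicalClosure _ ⟨a, rfl⟩
  have hinv (a : A) : ∀ x ∈ M, fkDiag ι (p a) x ∈ M := by
    intro x hx
    refine map_mem_closure (fkDiag ι (p a)).continuous hx ?_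
    rintro _ ⟨b, rfl⟩
    refine ⟨a * b, ?_⟩
    ext i; simp [L, fkDiag_apply]
  have hcomm (a : A) : M.starProjection * fkDiag ι (p a) = fkDiag ι (p a) * M.starProjection :=
    fk_proj_comm M _ (hinv a) (by rw [fkDiag_star, ← map_star]; exact hinv _)
  let inc (j : ι) : H →L[ℂ] FKG ι H := ((PiLp.continuousLinearEquiv 2 ℂ (fun _ : ι => H)).symm :
      (ι → H) →L[ℂ] (FKG ι H)) ∘L ContinuousLinearMap.single ℂ (fun _ : ι => H) j
  have hincD (j : ι) (S : H →L[ℂ] H) (x : H) : inc j (S x) = fkDiag ι S (inc j x) := by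
    ext i
    rw [fkDiag_apply]
    by_cases h : i = j
    · subst h; simp [inc]
    · simp [inc, h]
  have hsum (x : FKG ι H) : x = ∑ j, inc j (x j) := by
    ext i
    simp [inc, Pi.single_apply]
  have hz (i j : ι) : ∃ z : ℂ, (PiLp.proj 2 (fun _ : ι => H) i) ∘L M.starProjection ∘L inc j
      = z • (1 : H →L[ℂ] H) := by
    refine hirr _ fun a => ?_
    ext x
    have := congrArg (fun S : (FKG ι H) →L[ℂ] FKG ι H => S (inc j x) i) (hcomm a)
    simp only [fk_mul_apply, fkDiag_apply, ← hincD] at this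
    exact this
  choose z hz using hz
  have hP (x : FKG ι H) (i : ι) : M.starProjection x i = ∑ j, z i j • x j := by
    conv_lhs => rw [hsum x]
    rw [map_sum, WithLp.ofLp_sum, Finset.sum_apply]
    refine Finset.sum_congr rfl fun j _ => ?_
    exact congrArg (fun S : H →L[ℂ] H => S (x j)) (hz i j)
  have hPT (x : FKG ι H) : M.starProjection (fkDiag ι T x) = fkDiag ι T (M.starProjection x) := by
    ext i
    rw [hP, fkDiag_apply, hP, map_sum]
    simp [fkDiag_apply]
  have hVM : M.starProjection V = V := by
    rw [eq_comm, ← sub_eq_zero]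
    ext i
    refine hnd _ fun a => ?_
    have h1 : fkDiag ι (p a) (V - M.starProjection V) = 0 := by
      rw [map_sub]
      have h2 := congrArg (fun S : (FKG ι H) →L[ℂ] FKG ι H => S V) (hcomm a)
      simp only [fk_mul_apply] at h2
      rw [← h2, Submodule.starProjection_eq_self_iff.2 (hLM a), sub_self]
    exact congrArg (fun g : FKG ι H => g i) h1
  have hTM : fkDiag ι T V ∈ M := by
    rw [← hVM, ← hPT]; exact M.starProjection_apply_mem _
  have hort : ∀ x ∈ M, ⟪Y, x⟫_ℂ = 0 := by
    intro x hx
    have hcl : IsClosed {x : FKG ι H | ⟪Y, x⟫_ℂ = 0} :=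
      isClosed_eq (by fun_prop) continuous_const
    refine closure_minimal ?_ hcl hx
    rintro _ ⟨a, rfl⟩
    exact hy a
  exact hort _ hTM

theorem fk_real_closure {G : Type*} [NormedAddCommGroup G] [InnerProductSpace ℂ G]
    [CompleteSpace G] (S : Set G) (h0 : (0 : G) ∈ S) (hadd : ∀ x ∈ S, ∀ y ∈ S, x + y ∈ S)
    (hsmul : ∀ (r : ℝ), ∀ x ∈ S, (r : ℂ) • x ∈ S) (t : G)
    (ht : ∀ y : G, (∀ s ∈ S, (⟪y, s⟫_ℂ).re = 0) → (⟪y, t⟫_ℂ).re = 0) : t ∈ closure S := by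
  letI : InnerProductSpace ℝ G := InnerProductSpace.rclikeToReal ℂ G
  let K : Submodule ℝ G :=
    { carrier := S
      add_mem' := fun {x y} hx hy => hadd x hx y hy
      zero_mem' := h0
      smul_mem' := fun r x hx => by
        have := hsmul r x hx
        rwa [Complex.coe_smul] at this }
  have h1 : t ∈ (Submodule.orthogonal (𝕜 := ℝ) (Submodule.orthogonal (𝕜 := ℝ) K)) := by
    rw [Submodule.mem_orthogonal]
    intro y hy
    rw [Submodule.mem_orthogonal'] at hy
    exact ht y fun s hs => hy s hs
  rw [Submodule.orthogonal_orthogonal_eq_closure] at h1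
  exact h1

theorem fk_density_sa (p : A →⋆ₙₐ[ℂ] (H →L[ℂ] H))
    (hirr : ∀ T : H →L[ℂ] H, (∀ a, T * p a = p a * T) → ∃ z : ℂ, T = z • 1)
    (hnd : ∀ x : H, (∀ a, p a x = 0) → x = 0)
    {ι : Type*} [Fintype ι] (v : ι → H) (T : H →L[ℂ] H) (hT : IsSelfAdjoint T)
    {δ : ℝ} (hδ : 0 < δ) :
    ∃ h : A, IsSelfAdjoint h ∧ ∀ i, ‖p h (v i) - T (v i)‖ < δ := by
  let V : FKG ι H := WithLp.toLp 2 v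
  let S : Set (FKG ι H) := {x | ∃ h : A, IsSelfAdjoint h ∧ x = fkDiag ι (p h) V}
  have hsa (S : H →L[ℂ] H) (hS : IsSelfAdjoint S) (x y : H) :
      ⟪x, S y⟫_ℂ = ⟪S x, y⟫_ℂ := by
    rw [← ContinuousLinearMap.adjoint_inner_left, hS.adjoint_eq]
  have hre (S : H →L[ℂ] H) (hS : IsSelfAdjoint S) (y : ι → H) :
      (∑ i, ⟪y i, S (v i)⟫_ℂ) + (∑ i, ⟪v i, S (y i)⟫_ℂ) =
        ((2 * (∑ i, ⟪y i, S (v i)⟫_ℂ).re : ℝ) : ℂ) := by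
    have : (∑ i, ⟪v i, S (y i)⟫_ℂ) = (starRingEnd ℂ) (∑ i, ⟪y i, S (v i)⟫_ℂ) := by
      rw [map_sum]
      refine Finset.sum_congr rfl fun i _ => ?_
      rw [inner_conj_symm, hsa S hS]
    rw [this, Complex.add_conj]
  have hmem : fkDiag ι T V ∈ closure S := by
    refine fk_real_closure S ⟨0, .zero _, ?_⟩ ?_ ?_ _ ?_
    · ext i; simp [fkDiag_apply]
    · rintro _ ⟨a, ha, rfl⟩ _ ⟨b, hb, rfl⟩
      refine ⟨a + b, ha.add hb, ?_⟩
      ext i; simp [fkDiag_apply]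
    · rintro r _ ⟨a, ha, rfl⟩
      refine ⟨(r : ℂ) • a, ?_, ?_⟩
      · rw [IsSelfAdjoint, star_smul, ha.star_eq]; simp
      · ext i; simp only [fkDiag_apply, map_smul]; rfl
    · intro Y hY
      have hF : ∀ a : A, (∑ i, ⟪Y i, p a (v i)⟫_ℂ) + (∑ i, ⟪v i, p a (Y i)⟫_ℂ) = 0 := by
        have hF1 (h : A) (hh : IsSelfAdjoint h) :
            (∑ i, ⟪Y i, p h (v i)⟫_ℂ) + (∑ i, ⟪v i, p h (Y i)⟫_ℂ) = 0 := by
          rw [hre (p h) (hh.map p) (fun i => Y i)]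
          have := hY _ ⟨h, hh, rfl⟩
          rw [PiLp.inner_apply] at this
          simp only [fkDiag_apply] at this
          have h3 : (∑ i, ⟪Y i, p h (v i)⟫_ℂ).re = 0 := this
          rw [h3]; simp
        intro a
        have e1 := hF1 _ (realPart a).2
        have e2 := hF1 _ (imaginaryPart a).2
        have e3 : a = (realPart a : A) + Complex.I • (imaginaryPart a : A) :=
          (realPart_add_I_smul_imaginaryPart a).symm
        have e4 : (∑ i, ⟪Y i, p a (v i)⟫_ℂ) + (∑ i, ⟪v i, p a (Y i)⟫_ℂ) =
          ((∑ i, ⟪Y i, p (realPart a) (v i)⟫_ℂ) + (∑ i, ⟪v i, p (realPart a) (Y i)⟫_ℂ)) +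
          Complex.I * ((∑ i, ⟪Y i, p (imaginaryPart a) (v i)⟫_ℂ) +
            (∑ i, ⟪v i, p (imaginaryPart a) (Y i)⟫_ℂ)) := by
          conv_lhs => rw [e3]
          simp only [map_add, map_smul, add_apply,
            smul_apply, inner_add_right, inner_smul_right,
            Finset.sum_add_distrib, ← Finset.mul_sum]
          ring
        rw [e4, e1, e2]; simp
      have h5 := fk_density p hirr hnd (Sum.elim v (fun i => Y i)) (Sum.elim (fun i => Y i) v)
        (fun a => by simpa using hF a) T
      have h6 : (∑ i, ⟪Y i, T (v i)⟫_ℂ) + (∑ i, ⟪v i, T (Y i)⟫_ℂ) = 0 := by simpa using h5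
      rw [hre T hT (fun i => Y i)] at h6
      rw [PiLp.inner_apply]
      simp only [fkDiag_apply]
      have h7 : 2 * (∑ i, ⟪Y i, T (v i)⟫_ℂ).re = 0 := by exact_mod_cast h6
      have h8 : (∑ i, ⟪Y i, T (v i)⟫_ℂ).re = 0 := by linarith
      exact h8
  obtain ⟨_, ⟨h, hh, rfl⟩, hd⟩ := Metric.mem_closure_iff.1 hmem δ hδ
  refine ⟨h, hh, fun i => ?_⟩
  rw [dist_comm, dist_eq_norm] at hd
  refine lt_of_le_of_lt ?_ hd
  exact PiLp.norm_apply_le (fkDiag ι (p h) V - fkDiag ι T V) i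

end density

section count

variable {H : Type*} [NormedAddCommGroup H] [InnerProductSpace ℂ H] [CompleteSpace H]
  {A : Type*} [NonUnitalCStarAlgebra A] [PartialOrder A] [StarOrderedRing A]

/-- Bump function. -/
noncomputable def fkBump (k : ℕ) (t : ℝ) : ℝ := max 0 (1 - 4 * (t - (k + 1)) ^ 2)

theorem fkBump_cont (k : ℕ) : Continuous (fkBump k) := by
  unfold fkBump; fun_prop

theorem fkBump_zero (k : ℕ) : fkBump k 0 = 0 := by
  unfold fkBump
  rw [max_eq_left]
  have : (0 : ℝ) ≤ k := Nat.cast_nonneg k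
  nlinarith

theorem fkBump_nonneg (k : ℕ) (t : ℝ) : 0 ≤ fkBump k t := le_max_left _ _

theorem fkBump_sum (r : ℕ) (t : ℝ) : ∑ k : Fin r, fkBump k t ≤ 1 := by
  by_cases h : ∃ k : Fin r, fkBump k t ≠ 0
  · obtain ⟨k, hk⟩ := h
    have key (l : Fin r) (hl : fkBump l t ≠ 0) : (t - (l + 1)) ^ 2 < (1 / 2 : ℝ) ^ 2 := by
      by_contra hc
      apply hl
      unfold fkBump
      rw [max_eq_left]
      push Not at hc
      linarith
    rw [Finset.sum_eq_single k]
    · unfold fkBump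
      apply max_le
      · norm_num
      · nlinarith [sq_nonneg (t - ((k : ℕ) + 1))]
    · intro l _ hlk
      by_contra hl
      have h1 := abs_lt_of_sq_lt_sq' (key k hk) (by norm_num)
      have h2 := abs_lt_of_sq_lt_sq' (key l hl) (by norm_num)
      have h3 : ((l : ℕ) : ℝ) < (k : ℕ) + 1 := by linarith [h1.1, h1.2, h2.1, h2.2]
      have h4 : ((k : ℕ) : ℝ) < (l : ℕ) + 1 := by linarith [h1.1, h1.2, h2.1, h2.2]
      have h5 : (l : ℕ) < (k : ℕ) + 1 := by exact_mod_cast h3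
      have h6 : (k : ℕ) < (l : ℕ) + 1 := by exact_mod_cast h4
      apply hlk
      apply Fin.ext
      omega
    · intro h; exact absurd (Finset.mem_univ _) h
  · push Not at h
    rw [Finset.sum_congr rfl (fun k _ => h k)]
    simp

theorem fk_cont (p : A →⋆ₙₐ[ℂ] (H →L[ℂ] H)) : Continuous p :=
  AddMonoidHomClass.continuous_of_bound p 1 (fun a => by
    rw [one_mul]; exact NonUnitalStarAlgHom.norm_apply_le p a)

theorem fk_bump_inner (D : H →L[ℂ] H) (hD : IsSelfAdjoint D) (k : ℕ) (v : H) (hv : ‖v‖ = 1)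
    (h : ‖D v - ((k : ℂ) + 1) • v‖ < 1 / 4) :
    1 / 2 ≤ (⟪v, cfcₙ (fkBump k) D v⟫_ℂ).re := by
  rw [cfcₙ_eq_cfc (fkBump_cont k).continuousOn (fkBump_zero k)]
  have h1 : cfc (fun t : ℝ => 1 - 4 * (t - (k + 1)) ^ 2) D ≤ cfc (fkBump k) D := by
    apply cfc_mono
    · intro x _; exact le_max_right _ _
    · exact Continuous.continuousOn (by fun_prop)
    · exact (fkBump_cont k).continuousOn
  have h2 : cfc (fun t : ℝ => 1 - 4 * (t - (k + 1)) ^ 2) D =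
      1 - (4 : ℝ) • ((D - ((k : ℝ) + 1) • 1) ^ 2) := by
    rw [cfc_sub (fun _ : ℝ => (1 : ℝ)) (fun t : ℝ => 4 * (t - (k + 1)) ^ 2) D,
      cfc_const_one ℝ D, cfc_const_mul (4 : ℝ) (fun t : ℝ => (t - (k + 1)) ^ 2) D,
      cfc_pow (fun t : ℝ => (t - (k + 1))) 2 D,
      cfc_sub (fun t : ℝ => t) (fun _ : ℝ => ((k : ℝ) + 1)) D, cfc_id' ℝ D,
      cfc_const ((k : ℝ) + 1) D, Algebra.algebraMap_eq_smul_one]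
  rw [h2] at h1
  have h3 := ((ContinuousLinearMap.le_def _ _).1 h1).re_inner_nonneg_right v
  rw [sub_apply, inner_sub_right] at h3
  set R : H →L[ℂ] H := D - ((k : ℝ) + 1) • 1 with hR
  have hRs : IsSelfAdjoint R := by
    apply hD.sub
    exact IsSelfAdjoint.smul (IsSelfAdjoint.all _) (IsSelfAdjoint.one _)
  have hRv : R v = D v - ((k : ℂ) + 1) • v := by
    rw [hR, sub_apply]
    congr 1
    rw [smul_apply]
    change ((k : ℝ) + 1) • v = _
    rw [← Complex.coe_smul]
    push_cast
    rfl
  have h4 : ⟪v, (1 - (4 : ℝ) • (R ^ 2) : H →L[ℂ] H) v⟫_ℂ = ((1 - 4 * ‖R v‖ ^ 2 : ℝ) : ℂ) := by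
    rw [sub_apply, inner_sub_right, smul_apply, ← Complex.coe_smul, inner_smul_right, sq, fk_mul_apply,
      ← ContinuousLinearMap.adjoint_inner_left R, hRs.adjoint_eq]
    change ⟪v, v⟫_ℂ - _ = _
    rw [inner_self_eq_norm_sq_to_K, inner_self_eq_norm_sq_to_K, hv]
    push_cast
    simp
  rw [h4] at h3
  rw [← hRv] at h
  have h5 : ‖R v‖ ^ 2 ≤ (1 / 4) ^ 2 := pow_le_pow_left₀ (norm_nonneg _) h.le 2
  have h6 : (0 : ℝ) ≤ (⟪v, cfc (fkBump k) D v⟫_ℂ).re - (1 - 4 * ‖R v‖ ^ 2) := by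
    simpa only [map_sub, RCLike.re_to_complex, Complex.sub_re, Complex.ofReal_re] using h3
  nlinarith

theorem fk_bumps (p : A →⋆ₙₐ[ℂ] (H →L[ℂ] H))
    (hirr : ∀ T : H →L[ℂ] H, (∀ a, T * p a = p a * T) → ∃ z : ℂ, T = z • 1)
    (hnd : ∀ x : H, (∀ a, p a x = 0) → x = 0)
    (r : ℕ) (v : Fin r → H) (hv : Orthonormal ℂ v) :
    ∃ e : Fin r → A, (∀ k, 0 ≤ e k) ∧ ‖∑ k, e k‖ ≤ 1 ∧
      ∀ k, 1 / 2 ≤ (⟪v k, p (e k) (v k)⟫_ℂ).re := by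
  let T : H →L[ℂ] H := ∑ k : Fin r, (((k : ℕ) : ℝ) + 1) • InnerProductSpace.rankOne ℂ (v k) (v k)
  have hT : IsSelfAdjoint T := by
    refine isSelfAdjoint_sum _ fun k _ => ?_
    exact IsSelfAdjoint.smul (IsSelfAdjoint.all _)
      (InnerProductSpace.isPositive_rankOne_self (v k)).isSelfAdjoint
  have hTv (k : Fin r) : T (v k) = (((k : ℕ) : ℂ) + 1) • v k := by
    simp only [T]
    rw [sum_apply, Finset.sum_eq_single k]
    · rw [smul_apply, InnerProductSpace.rankOne_apply, inner_self_eq_norm_sq_to_K, hv.1 k,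
        ← Complex.coe_smul]
      simp
    · intro l _ hl
      rw [smul_apply, InnerProductSpace.rankOne_apply, hv.2 hl]
      simp
    · intro h; exact absurd (Finset.mem_univ _) h
  obtain ⟨h, hh, hd⟩ := fk_density_sa p hirr hnd v T hT (δ := 1 / 4) (by norm_num)
  refine ⟨fun k => cfcₙ (fkBump k) h, fun k => cfcₙ_nonneg fun x _ => fkBump_nonneg k x, ?_, ?_⟩
  · rw [← cfcₙ_sum_univ (fun k : Fin r => fkBump k) h (fun k => (fkBump_cont k).continuousOn)
      (fun k => fkBump_zero k)]
    apply norm_cfcₙ_le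
    intro x _
    rw [Finset.sum_apply, Real.norm_of_nonneg
      (Finset.sum_nonneg fun (k : Fin r) _ => fkBump_nonneg (k : ℕ) x)]
    exact fkBump_sum r x
  · intro k
    have : p (cfcₙ (fkBump k) h) = cfcₙ (fkBump k) (p h) :=
      NonUnitalStarAlgHomClass.map_cfcₙ p (fkBump k) h (fkBump_cont k).continuousOn (fkBump_zero k)
        (fk_cont p) hh (hh.map p)
    rw [this]
    refine fk_bump_inner (p h) (hh.map p) k (v k) (hv.1 k) ?_
    rw [← hTv]
    exact hd k

theorem fk_fourier (r : ℕ) (k l : Fin r) (ζ : ℂ) (hζ : IsPrimitiveRoot ζ r) :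
    ∑ j : Fin r, (starRingEnd ℂ) (ζ ^ ((j : ℕ) * k)) * ζ ^ ((j : ℕ) * l) =
      if k = l then (r : ℂ) else 0 := by
  have hr : r ≠ 0 := by
    rintro rfl
    exact k.elim0
  have hn : ‖ζ‖ = 1 := hζ.norm'_eq_one hr
  have hcz : (starRingEnd ℂ) ζ * ζ = 1 := by
    rw [mul_comm, Complex.mul_conj, Complex.normSq_eq_norm_sq, hn]; simp
  set w : ℂ := (starRingEnd ℂ) ζ ^ (k : ℕ) * ζ ^ (l : ℕ) with hw
  have h1 (j : Fin r) : (starRingEnd ℂ) (ζ ^ ((j : ℕ) * k)) * ζ ^ ((j : ℕ) * l) = w ^ (j : ℕ) := by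
    rw [hw, mul_pow, map_pow, ← pow_mul, ← pow_mul, mul_comm (j : ℕ), mul_comm (j : ℕ)]
  rw [Finset.sum_congr rfl fun j _ => h1 j]
  split_ifs with hkl
  · have : w = 1 := by rw [hw, hkl, ← mul_pow, hcz, one_pow]
    simp [this]
  · have hw1 : w ≠ 1 := by
      intro h
      apply hkl
      have h2 : ζ ^ (l : ℕ) = ζ ^ (k : ℕ) := by
        calc ζ ^ (l : ℕ) = ((starRingEnd ℂ) ζ * ζ) ^ (k : ℕ) * ζ ^ (l : ℕ) := by
              rw [hcz, one_pow, one_mul]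
          _ = ζ ^ (k : ℕ) * w := by rw [hw, mul_pow]; ring
          _ = ζ ^ (k : ℕ) := by rw [h, mul_one]
      exact Fin.ext (hζ.pow_inj k.2 l.2 h2.symm)
    have hwr : w ^ r = 1 := by
      have h3 : (starRingEnd ℂ) ζ ^ r = 1 := by rw [← map_pow, hζ.pow_eq_one, map_one]
      rw [hw, mul_pow, ← pow_mul, ← pow_mul, mul_comm (k : ℕ), mul_comm (l : ℕ), pow_mul, pow_mul,
        hζ.pow_eq_one, h3, one_pow, one_pow, one_mul]
    rw [Fin.sum_univ_eq_sum_range (fun j => w ^ j), geom_sum_eq hw1, hwr]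
    simp

theorem fk_le (p : A →⋆ₙₐ[ℂ] (H →L[ℂ] H)) {γ : ℝ} {a b : A} (h : a ≤ γ • b) (x : H) :
    (⟪x, p a x⟫_ℂ).re ≤ γ * (⟪x, p b x⟫_ℂ).re := by
  have h2 : 0 ≤ γ • b - a := sub_nonneg.2 h
  obtain ⟨c, hc⟩ := CStarAlgebra.nonneg_iff_eq_star_mul_self.1 h2
  have h3 : 0 ≤ (⟪x, p (γ • b - a) x⟫_ℂ).re := by
    rw [hc, map_mul, map_star, fk_mul_apply, ContinuousLinearMap.star_eq_adjoint,
      ContinuousLinearMap.adjoint_inner_right]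
    exact inner_self_nonneg (𝕜 := ℂ)
  rw [map_sub, ← Complex.coe_smul, map_smul, sub_apply, inner_sub_right, smul_apply,
    inner_smul_right, Complex.sub_re, Complex.re_ofReal_mul] at h3
  linarith

theorem fk_count (p : A →⋆ₙₐ[ℂ] (H →L[ℂ] H))
    (hirr : ∀ T : H →L[ℂ] H, (∀ a, T * p a = p a * T) → ∃ z : ℂ, T = z • 1)
    (hnd : ∀ x : H, (∀ a, p a x = 0) → x = 0)
    (B : NonUnitalStarSubalgebra ℂ A) (E : A →L[ℂ] A) (hrange : ∀ a : A, E a ∈ B)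
    (γ : ℝ) (hγ : 1 ≤ γ) (hE : ∀ a : A, 0 ≤ a → a ≤ γ • E a)
    (r : ℕ) (η : Fin r → H) (hη : Orthonormal ℂ η)
    (hηB : ∀ b ∈ B, ∀ i j, i ≠ j → ⟪η i, p b (η j)⟫_ℂ = 0) :
    (r : ℝ) ≤ 2 * γ * ‖E‖ := by
  rcases Nat.eq_zero_or_pos r with rfl | hr
  · simp; positivity
  have hr0 : (r : ℂ) ≠ 0 := by exact_mod_cast hr.ne'
  have hrR : (0 : ℝ) < r := by exact_mod_cast hr
  obtain ⟨ζ, hζ⟩ : ∃ ζ : ℂ, IsPrimitiveRoot ζ r := ⟨_, Complex.isPrimitiveRoot_exp r hr.ne'⟩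
  have hn : ‖ζ‖ = 1 := hζ.norm'_eq_one hr.ne'
  let s : ℂ := ((Real.sqrt r)⁻¹ : ℝ)
  have hs : (starRingEnd ℂ) s * s = (r : ℂ)⁻¹ := by
    simp only [s]
    rw [Complex.conj_ofReal, ← Complex.ofReal_mul, ← mul_inv, Real.mul_self_sqrt hrR.le]
    simp
  let v : Fin r → H := fun k => s • ∑ j : Fin r, ζ ^ ((j : ℕ) * k) • η j
  have hgen (S : H →L[ℂ] H) (hS : ∀ i j, i ≠ j → ⟪η i, S (η j)⟫_ℂ = 0) (k l : Fin r) :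
      ⟪v k, S (v l)⟫_ℂ = (r : ℂ)⁻¹ * ∑ j : Fin r,
        (starRingEnd ℂ) (ζ ^ ((j : ℕ) * k)) * ζ ^ ((j : ℕ) * l) * ⟪η j, S (η j)⟫_ℂ := by
    simp only [v]
    rw [map_smul, inner_smul_left, inner_smul_right, ← mul_assoc, hs, map_sum, sum_inner]
    congr 1
    refine Finset.sum_congr rfl fun j _ => ?_
    rw [inner_sum, Finset.sum_eq_single j]
    · rw [map_smul, inner_smul_left, inner_smul_right, mul_assoc]
    · intro i _ hij
      rw [map_smul, inner_smul_left, inner_smul_right, hS j i hij.symm]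
      simp
    · intro h; exact absurd (Finset.mem_univ _) h
  have hv : Orthonormal ℂ v := by
    rw [orthonormal_iff_ite]
    intro k l
    have := hgen 1 (fun i j hij => hη.2 hij) k l
    change ⟪v k, v l⟫_ℂ = _ at this
    rw [this]
    have h2 : ∀ j, ⟪η j, (1 : H →L[ℂ] H) (η j)⟫_ℂ = 1 := fun j => by
      change ⟪η j, η j⟫_ℂ = 1
      rw [inner_self_eq_norm_sq_to_K, hη.1 j]; simp
    rw [Finset.sum_congr rfl (fun j _ => by rw [h2 j, mul_one]), fk_fourier r k l ζ hζ]
    split_ifs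
    · exact inv_mul_cancel₀ hr0
    · simp
  have hvB (b : A) (hb : b ∈ B) (k : Fin r) :
      ⟪v k, p b (v k)⟫_ℂ = (r : ℂ)⁻¹ * ∑ j : Fin r, ⟪η j, p b (η j)⟫_ℂ := by
    rw [hgen (p b) (hηB b hb) k k]
    congr 1
    refine Finset.sum_congr rfl fun j _ => ?_
    rw [mul_comm ((starRingEnd ℂ) _), Complex.mul_conj, Complex.normSq_eq_norm_sq, norm_pow, hn]
    simp
  obtain ⟨e, he0, hes, hek⟩ := fk_bumps p hirr hnd r v hv
  let k0 : Fin r := ⟨0, hr⟩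
  have h1 (k : Fin r) : 1 / 2 ≤ γ * (⟪v k0, p (E (e k)) (v k0)⟫_ℂ).re := by
    have h3 := fk_le p (hE _ (he0 k)) (v k)
    rw [hvB _ (hrange _) k, ← hvB _ (hrange _) k0] at h3
    linarith [hek k]
  have h4 : (r : ℝ) * (1 / 2) ≤ γ * (⟪v k0, p (E (∑ k, e k)) (v k0)⟫_ℂ).re := by
    rw [map_sum, map_sum, sum_apply, inner_sum, Complex.re_sum, Finset.mul_sum]
    calc (r : ℝ) * (1 / 2) = ∑ k : Fin r, (1 / 2 : ℝ) := by simp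
      _ ≤ _ := Finset.sum_le_sum fun k _ => h1 k
  have h5 : (⟪v k0, p (E (∑ k, e k)) (v k0)⟫_ℂ).re ≤ ‖E‖ := by
    calc _ ≤ ‖⟪v k0, p (E (∑ k, e k)) (v k0)⟫_ℂ‖ := Complex.re_le_norm _
      _ ≤ ‖v k0‖ * ‖p (E (∑ k, e k)) (v k0)‖ := norm_inner_le_norm _ _
      _ ≤ ‖v k0‖ * (‖p (E (∑ k, e k))‖ * ‖v k0‖) := by
          gcongr; exact ContinuousLinearMap.le_opNorm _ _
      _ = ‖p (E (∑ k, e k))‖ := by rw [hv.1 k0]; ring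
      _ ≤ ‖E (∑ k, e k)‖ := NonUnitalStarAlgHom.norm_apply_le p _
      _ ≤ ‖E‖ * ‖∑ k, e k‖ := E.le_opNorm _
      _ ≤ ‖E‖ * 1 := by gcongr
      _ = ‖E‖ := mul_one _
  nlinarith



theorem fk_inner_star (p : A →⋆ₙₐ[ℂ] (H →L[ℂ] H)) (a : A) (x y : H) :
    ⟪x, p a y⟫_ℂ = ⟪p (star a) x, y⟫_ℂ := by
  rw [map_star, ContinuousLinearMap.star_eq_adjoint, ContinuousLinearMap.adjoint_inner_left]

theorem fk_norm_sq_le (p : A →⋆ₙₐ[ℂ] (H →L[ℂ] H)) (E : A →L[ℂ] A)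
    (γ : ℝ) (hE : ∀ a : A, 0 ≤ a → a ≤ γ • E a) (c : A) (x : H) :
    ‖p c x‖ ^ 2 ≤ γ * (⟪x, p (E (star c * c)) x⟫_ℂ).re := by
  have h := fk_le p (hE _ (star_mul_self_nonneg c)) x
  rw [map_mul, map_star, fk_mul_apply, ContinuousLinearMap.star_eq_adjoint,
    ContinuousLinearMap.adjoint_inner_right, inner_self_eq_norm_sq_to_K] at h
  refine le_trans (le_of_eq ?_) h
  norm_cast

theorem fk_nd (p : A →⋆ₙₐ[ℂ] (H →L[ℂ] H)) (hnd : ∀ x : H, (∀ a, p a x = 0) → x = 0)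
    (B : NonUnitalStarSubalgebra ℂ A) (E : A →L[ℂ] A) (hrange : ∀ a : A, E a ∈ B)
    (γ : ℝ) (hE : ∀ a : A, 0 ≤ a → a ≤ γ • E a) (x : H) (hx : ∀ b ∈ B, p b x = 0) : x = 0 := by
  apply hnd
  intro a
  have h := fk_norm_sq_le p E γ hE a x
  rw [hx _ (hrange _), inner_zero_right, Complex.zero_re, mul_zero] at h
  exact norm_eq_zero.1 (pow_eq_zero_iff (two_ne_zero) |>.1 (le_antisymm h (sq_nonneg _)))

/-- The orbit of a vector. -/
def fkOrb (p : A →⋆ₙₐ[ℂ] (H →L[ℂ] H)) (B : NonUnitalStarSubalgebra ℂ A) (η : H) :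
    Submodule ℂ H where
  carrier := {x | ∃ b ∈ B, x = p b η}
  add_mem' := by
    rintro _ _ ⟨a, ha, rfl⟩ ⟨b, hb, rfl⟩
    exact ⟨a + b, add_mem ha hb, by rw [map_add, add_apply]⟩
  zero_mem' := ⟨0, zero_mem _, by rw [map_zero]; rfl⟩
  smul_mem' := by
    rintro c _ ⟨a, ha, rfl⟩
    exact ⟨c • a, SMulMemClass.smul_mem c ha, by rw [map_smul, smul_apply]⟩

theorem fk_orth (p : A →⋆ₙₐ[ℂ] (H →L[ℂ] H))
    (B : NonUnitalStarSubalgebra ℂ A) (hndB : ∀ x : H, (∀ b ∈ B, p b x = 0) → x = 0)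
    (η x : H) (hx : ∀ b ∈ B, ⟪p b η, x⟫_ℂ = 0) : ⟪η, x⟫_ℂ = 0 := by
  let K := (fkOrb p B η).topologicalClosure
  have hinv (b : A) (hb : b ∈ B) : ∀ y ∈ K, p b y ∈ K := by
    intro y hy
    have : Set.MapsTo (p b) (fkOrb p B η : Set H) (fkOrb p B η : Set H) := by
      rintro _ ⟨a, ha, rfl⟩
      exact ⟨b * a, mul_mem hb ha, by rw [map_mul, fk_mul_apply]⟩
    exact this.closure (p b).continuous hy
  have hmem : η ∈ K := by
    rw [← Submodule.starProjection_eq_self_iff (K := K), eq_comm, ← sub_eq_zero]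
    apply hndB
    intro b hb
    have h1 := fk_proj_comm K (p b) (hinv b hb) (by
      rw [← map_star]; exact hinv _ (star_mem hb))
    have h2 : K.starProjection (p b η) = p b (K.starProjection η) := by
      rw [← fk_mul_apply, h1, fk_mul_apply]
    rw [map_sub, ← h2, sub_eq_zero, eq_comm, Submodule.starProjection_eq_self_iff]
    exact subset_closure ⟨b, hb, rfl⟩
  have hcl : IsClosed {y : H | ⟪y, x⟫_ℂ = 0} :=
    isClosed_eq (by fun_prop) continuous_const
  have hsub : (fkOrb p B η : Set H) ⊆ {y : H | ⟪y, x⟫_ℂ = 0} := by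
    rintro _ ⟨b, hb, rfl⟩
    exact hx b hb
  exact closure_minimal hsub hcl hmem

theorem fk_family (p : A →⋆ₙₐ[ℂ] (H →L[ℂ] H))
    (hirr : ∀ T : H →L[ℂ] H, (∀ a, T * p a = p a * T) → ∃ z : ℂ, T = z • 1)
    (hnd : ∀ x : H, (∀ a, p a x = 0) → x = 0)
    (B : NonUnitalStarSubalgebra ℂ A) (E : A →L[ℂ] A) (hrange : ∀ a : A, E a ∈ B)
    (γ : ℝ) (hγ : 1 ≤ γ) (hE : ∀ a : A, 0 ≤ a → a ≤ γ • E a) :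
    ∃ (r : ℕ) (η : Fin r → H), (r : ℝ) ≤ 2 * γ * ‖E‖ ∧
      (∀ b ∈ B, ∀ i j, i ≠ j → ⟪η i, p b (η j)⟫_ℂ = 0) ∧
      ∀ x, (∀ j, ∀ b ∈ B, ⟪p b (η j), x⟫_ℂ = 0) → x = 0 := by
  by_contra hcon
  have key (r : ℕ) : ∃ η : Fin r → H, Orthonormal ℂ η ∧
      (∀ b ∈ B, ∀ i j, i ≠ j → ⟪η i, p b (η j)⟫_ℂ = 0) := by
    induction r with
    | zero => exact ⟨fun i => i.elim0, ⟨fun i => i.elim0, fun i => i.elim0⟩,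
        fun _ _ i => i.elim0⟩
    | succ r ih =>
      obtain ⟨η, hη, hηB⟩ := ih
      have hc := fk_count p hirr hnd B E hrange γ hγ hE r η hη hηB
      have : ∃ x, (∀ j, ∀ b ∈ B, ⟪p b (η j), x⟫_ℂ = 0) ∧ x ≠ 0 := by
        by_contra hno
        push Not at hno
        exact hcon ⟨r, η, hc, hηB, hno⟩
      obtain ⟨x0, hx0, hne⟩ := this
      let x : H := ((‖x0‖ : ℂ)⁻¹) • x0
      have hxn : ‖x‖ = 1 := norm_smul_inv_norm hne
      have hx (j : Fin r) (b : A) (hb : b ∈ B) : ⟪p b (η j), x⟫_ℂ = 0 := by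
        simp only [x]
        rw [inner_smul_right, hx0 j b hb, mul_zero]
      have hxo (j : Fin r) : ⟪η j, x⟫_ℂ = 0 :=
        fk_orth p B (fk_nd p hnd B E hrange γ hE) (η j) x (hx j)
      refine ⟨Fin.cons x η, ⟨?_, ?_⟩, ?_⟩
      · intro i
        refine Fin.cases ?_ (fun i => ?_) i
        · exact hxn
        · exact hη.1 i
      · intro i j
        refine Fin.cases ?_ (fun i => ?_) i <;> refine Fin.cases ?_ (fun j => ?_) j
        · intro h; exact absurd rfl h
        · intro _
          simp only [Fin.cons_zero, Fin.cons_succ]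
          rw [← inner_conj_symm, hxo j, map_zero]
        · intro _
          simp only [Fin.cons_zero, Fin.cons_succ]
          exact hxo i
        · intro h
          simp only [Fin.cons_succ]
          exact hη.2 fun h' => h (by rw [h'])
      · intro b hb i j
        refine Fin.cases ?_ (fun i => ?_) i <;> refine Fin.cases ?_ (fun j => ?_) j
        · intro h; exact absurd rfl h
        · intro _
          simp only [Fin.cons_zero, Fin.cons_succ]
          rw [← inner_conj_symm, hx j b hb, map_zero]
        · intro _
          simp only [Fin.cons_zero, Fin.cons_succ]
          rw [fk_inner_star]
          exact hx i _ (star_mem hb)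
        · intro h
          simp only [Fin.cons_succ]
          exact hηB b hb i j fun h' => h (by rw [h'])
  obtain ⟨η, hη, hηB⟩ := key (⌊2 * γ * ‖E‖⌋₊ + 1)
  have hc := fk_count p hirr hnd B E hrange γ hγ hE _ η hη hηB
  have := Nat.lt_floor_add_one (2 * γ * ‖E‖)
  push_cast at hc
  linarith

theorem fk_row_expand (p : A →⋆ₙₐ[ℂ] (H →L[ℂ] H))
    (B : NonUnitalStarSubalgebra ℂ A) (E : A →L[ℂ] A)
    (hbimod : ∀ b ∈ B, ∀ b' ∈ B, ∀ x : A, E (b * x * b') = b * E x * b')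
    {n : ℕ} (a b : Fin n → A) (hb : ∀ i, b i ∈ B) (x : H) :
    ⟪x, p (E (star (∑ i, a i * b i) * (∑ i, a i * b i))) x⟫_ℂ =
      ∑ i, ∑ k, ⟪p (b i) x, p (E (star (a i) * a k)) (p (b k) x)⟫_ℂ := by
  have h1 : star (∑ i, a i * b i) * (∑ i, a i * b i) =
      ∑ i, ∑ k, star (b i) * (star (a i) * a k) * b k := by
    rw [star_sum, Finset.sum_mul_sum]
    refine Finset.sum_congr rfl fun i _ => Finset.sum_congr rfl fun k _ => ?_
    rw [star_mul]; noncomm_ring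
  rw [h1]
  simp only [map_sum, sum_apply, inner_sum]
  refine Finset.sum_congr rfl fun i _ => Finset.sum_congr rfl fun k _ => ?_
  rw [hbimod _ (star_mem (hb i)) _ (hb k), map_mul, map_mul, fk_mul_apply, fk_mul_apply,
    fk_inner_star, star_star]

theorem fk_row (p : A →⋆ₙₐ[ℂ] (H →L[ℂ] H))
    (hirr : ∀ T : H →L[ℂ] H, (∀ a, T * p a = p a * T) → ∃ z : ℂ, T = z • 1)
    (hnd : ∀ x : H, (∀ a, p a x = 0) → x = 0)
    (B : NonUnitalStarSubalgebra ℂ A) (E : A →L[ℂ] A) (hrange : ∀ a : A, E a ∈ B)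
    (hbimod : ∀ b ∈ B, ∀ b' ∈ B, ∀ x : A, E (b * x * b') = b * E x * b')
    (γ : ℝ) (hγ : 1 ≤ γ) (hE : ∀ a : A, 0 ≤ a → a ≤ γ • E a)
    (M : ℝ) (hM : 2 * γ * ‖E‖ ≤ M) {n : ℕ} (a : Fin n → A) (ξ : Fin n → H) :
    ‖∑ i, p (a i) (ξ i)‖ ^ 2 ≤ (M * γ) *
      (∑ i, ∑ k, ⟪ξ i, p (E (star (a i) * a k)) (ξ k)⟫_ℂ).re := by
  obtain ⟨r, η, hr, hηB, htot⟩ := fk_family p hirr hnd B E hrange γ hγ hE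
  let D : Submodule ℂ H := ⨆ j, fkOrb p B (η j)
  have hD : Dense (D : Set H) := by
    rw [Submodule.dense_iff_topologicalClosure_eq_top, Submodule.topologicalClosure_eq_top_iff,
      Submodule.eq_bot_iff]
    intro x hx
    apply htot
    intro j b hb
    exact hx _ (le_iSup (fun j => fkOrb p B (η j)) j ⟨b, hb, rfl⟩)
  have hDm (x : H) (hx : x ∈ D) : ∃ b : Fin r → A, (∀ j, b j ∈ B) ∧ x = ∑ j, p (b j) (η j) := by
    obtain ⟨f, hf⟩ := (Submodule.mem_iSup_iff_exists_finsupp _ _).1 hx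
    choose b hb hbe using fun j => hf.1 j
    refine ⟨b, hb, ?_⟩
    rw [← hf.2, Finsupp.sum_fintype _ _ (fun _ => rfl)]
    exact Finset.sum_congr (M := H) rfl fun j _ => hbe j
  have hdense : Dense (Set.univ.pi fun _ : Fin n => (D : Set H)) := dense_pi _ fun _ _ => hD
  have hcl : IsClosed {ξ : Fin n → H | ‖∑ i, p (a i) (ξ i)‖ ^ 2 ≤ (M * γ) *
      (∑ i, ∑ k, ⟪ξ i, p (E (star (a i) * a k)) (ξ k)⟫_ℂ).re} := by
    apply isClosed_le
    · fun_prop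
    · fun_prop
  suffices h : (Set.univ.pi fun _ : Fin n => (D : Set H)) ⊆
      {ξ : Fin n → H | ‖∑ i, p (a i) (ξ i)‖ ^ 2 ≤ (M * γ) *
      (∑ i, ∑ k, ⟪ξ i, p (E (star (a i) * a k)) (ξ k)⟫_ℂ).re} from
    closure_minimal h hcl (hdense ξ)
  intro ξ hξ
  choose b hb hbe using fun i => hDm (ξ i) (hξ i (Set.mem_univ _))
  obtain rfl : ξ = fun i => ∑ j, p (b i j) (η j) := funext hbe
  change ‖∑ i, p (a i) (∑ j, p (b i j) (η j))‖ ^ 2 ≤ (M * γ) *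
      (∑ i, ∑ k, ⟪∑ j, p (b i j) (η j), p (E (star (a i) * a k)) (∑ j, p (b k j) (η j))⟫_ℂ).re
  let c : Fin r → A := fun j => ∑ i, a i * b i j
  have hL : ∑ i, p (a i) (∑ j, p (b i j) (η j)) = ∑ j, p (c j) (η j) := by
    simp only [c, map_sum, sum_apply, map_mul, fk_mul_apply]
    exact Finset.sum_comm
  have hR : ∑ i, ∑ k, ⟪∑ j, p (b i j) (η j), p (E (star (a i) * a k)) (∑ j, p (b k j) (η j))⟫_ℂ
      = ∑ j, ⟪η j, p (E (star (c j) * c j)) (η j)⟫_ℂ := by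
    have h1 (j : Fin r) := fk_row_expand p B E hbimod a (fun i => b i j) (fun i => hb i j) (η j)
    rw [Finset.sum_congr rfl fun j _ => h1 j, eq_comm, Finset.sum_comm]
    refine Finset.sum_congr rfl fun i _ => ?_
    rw [Finset.sum_comm]
    refine Finset.sum_congr rfl fun k _ => ?_
    rw [sum_inner, eq_comm]
    refine Finset.sum_congr rfl fun j _ => ?_
    rw [map_sum, inner_sum, Finset.sum_eq_single j]
    · intro l _ hl
      have := hηB (star (b i j) * (E (star (a i) * a k) * b k l))
        (mul_mem (star_mem (hb i j)) (mul_mem (hrange _) (hb k l))) j l hl.symm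
      rw [map_mul, map_mul, fk_mul_apply, fk_mul_apply, fk_inner_star, star_star] at this
      exact this
    · intro h; exact absurd (Finset.mem_univ _) h
  rw [hL, hR, Complex.re_sum]
  have h2 (j : Fin r) := fk_norm_sq_le p E γ hE (c j) (η j)
  calc ‖∑ j, p (c j) (η j)‖ ^ 2 ≤ (∑ j, ‖p (c j) (η j)‖) ^ 2 := by
        gcongr; exact norm_sum_le _ _
    _ ≤ (r : ℝ) * ∑ j, ‖p (c j) (η j)‖ ^ 2 := by
        simpa using sq_sum_le_card_mul_sum_sq (s := Finset.univ) (f := fun j => ‖p (c j) (η j)‖)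
    _ ≤ M * ∑ j, ‖p (c j) (η j)‖ ^ 2 := by
        gcongr
        exact hr.trans hM
    _ ≤ M * ∑ j, γ * (⟪η j, p (E (star (c j) * c j)) (η j)⟫_ℂ).re := by
        refine mul_le_mul_of_nonneg_left (Finset.sum_le_sum fun j _ => h2 j) ?_
        exact le_trans (by positivity) hM
    _ = _ := by rw [← Finset.mul_sum]; ring

end count

theorem fk_E_star {A : Type*} [NonUnitalCStarAlgebra A] [PartialOrder A] [StarOrderedRing A]
    (E : A →L[ℂ] A) (hpos : ∀ a : A, 0 ≤ a → 0 ≤ E a) (a : A) : E (star a) = star (E a) := by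
  have h1 (a : A) (ha : IsSelfAdjoint a) : star (E a) = E a := by
    rw [← CFC.posPart_sub_negPart a ha, map_sub, star_sub,
      (IsSelfAdjoint.of_nonneg (hpos _ (CFC.posPart_nonneg a))).star_eq,
      (IsSelfAdjoint.of_nonneg (hpos _ (CFC.negPart_nonneg a))).star_eq]
  have e3 : a = (realPart a : A) + Complex.I • (imaginaryPart a : A) :=
    (realPart_add_I_smul_imaginaryPart a).symm
  have e4 : star a = (realPart a : A) - Complex.I • (imaginaryPart a : A) := by
    conv_lhs => rw [e3]
    rw [star_add, star_smul, (realPart a).2.star_eq, (imaginaryPart a).2.star_eq]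
    simp [sub_eq_add_neg]
  rw [e4]
  conv_rhs => rw [e3]
  rw [map_sub, map_add, map_smul, star_add, star_smul, h1 _ (realPart a).2,
    h1 _ (imaginaryPart a).2]
  simp [sub_eq_add_neg]

theorem fk_jordan {M : Type*} [NonUnitalCStarAlgebra M] (X : M) (hX : IsSelfAdjoint X) :
    ∃ N s t : M, X = star t * t - N ∧ N * (star t * t) = 0 ∧ star N = N ∧ N = star s * s := by
  letI : PartialOrder M := CStarAlgebra.spectralOrder M
  haveI : StarOrderedRing M := CStarAlgebra.spectralOrderedRing M
  obtain ⟨s, hs⟩ := CStarAlgebra.nonneg_iff_eq_star_mul_self.1 (CFC.negPart_nonneg X)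
  obtain ⟨t, ht⟩ := CStarAlgebra.nonneg_iff_eq_star_mul_self.1 (CFC.posPart_nonneg X)
  refine ⟨X⁻, s, t, ?_, ?_, ?_, hs⟩
  · rw [← ht, CFC.posPart_sub_negPart X hX]
  · rw [← ht, CFC.negPart_mul_posPart]
  · exact (IsSelfAdjoint.of_nonneg (CFC.negPart_nonneg X)).star_eq

theorem fk_mat_pos {A : Type*} [NonUnitalCStarAlgebra A] [PartialOrder A] [StarOrderedRing A]
    {n : ℕ} (X : CStarMatrix (Fin n) (Fin n) A) (hX : IsSelfAdjoint X)
    (h : ∀ y : Fin n → A, 0 ≤ ∑ i, ∑ j, star (y i) * X i j * y j) :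
    ∃ Y : CStarMatrix (Fin n) (Fin n) A, X = star Y * Y := by
  obtain ⟨N, s, t, hNt, hNP, hNs, hs⟩ := fk_jordan X hX
  suffices h0 : N = 0 by
    rw [h0, sub_zero] at hNt
    exact ⟨t, hNt⟩
  have h3 : N * X * N = - (star (s * N) * (s * N)) := by
    rw [hNt, mul_sub, hNP, zero_sub, neg_mul, star_mul, hNs]
    congr 1
    calc N * N * N = N * (star s * s) * N := by rw [← hs]
      _ = _ := by noncomm_ring
  have hZ : s * N = 0 := by
    have hd (j : Fin n) : ∑ k, star ((s * N) k j) * (s * N) k j = 0 := by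
      have e1 : ∑ k, star ((s * N) k j) * (s * N) k j = (star (s * N) * (s * N)) j j := by
        rw [CStarMatrix.mul_apply]; rfl
      have e2 : ∑ i, ∑ k, star (N i j) * X i k * N k j = (N * X * N) j j := by
        rw [mul_assoc, CStarMatrix.mul_apply]
        refine Finset.sum_congr rfl fun i _ => ?_
        rw [CStarMatrix.mul_apply, Finset.mul_sum]
        refine Finset.sum_congr rfl fun k _ => ?_
        have e3 : star (N i j) = N j i := by
          conv_rhs => rw [← hNs]
          rfl
        rw [e3, mul_assoc]
      have h4 := h (fun i => N i j)
      rw [e2, h3, CStarMatrix.neg_apply, ← e1] at h4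
      exact le_antisymm (neg_nonneg.1 h4) (Finset.sum_nonneg fun k _ => star_mul_self_nonneg _)
    ext k j
    have h5 := (Finset.sum_eq_zero_iff_of_nonneg
      (fun k _ => star_mul_self_nonneg ((s * N) k j))).1 (hd j) k (Finset.mem_univ _)
    exact CStarRing.star_mul_self_eq_zero_iff _ |>.1 h5
  have h6 : star N * N = 0 := by
    rw [hNs]
    calc N * N = (star s * s) * N := by rw [← hs]
      _ = star s * (s * N) := by rw [mul_assoc]
      _ = 0 := by rw [hZ, mul_zero]
  exact CStarRing.star_mul_self_eq_zero_iff _ |>.1 h6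

theorem fk_forward {A : Type*} [NonUnitalCStarAlgebra A] [PartialOrder A] [StarOrderedRing A]
    (B : NonUnitalStarSubalgebra ℂ A) (E : A →L[ℂ] A) (hrange : ∀ a : A, E a ∈ B)
    (hpos : ∀ a : A, 0 ≤ a → 0 ≤ E a)
    (hbimod : ∀ b ∈ B, ∀ b' ∈ B, ∀ x : A, E (b * x * b') = b * E x * b')
    (γ : ℝ) (hγ : 1 ≤ γ) (hE : ∀ a : A, 0 ≤ a → a ≤ γ • E a)
    (M : ℝ) (hM : 2 * γ * ‖E‖ ≤ M) (n : ℕ) (x : Matrix (Fin n) (Fin n) A) :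
    ∃ y : Matrix (Fin n) (Fin n) A, (M * γ) • (xᴴ * x).map ⇑E - (xᴴ * x) = yᴴ * y := by
  set L := M * γ with hL
  have hEs := fk_E_star E hpos
  let m : Matrix (Fin n) (Fin n) A := xᴴ * x
  have hm (i j : Fin n) : m i j = ∑ k, star (x k i) * x k j := by
    simp only [m, Matrix.mul_apply, Matrix.conjTranspose_apply]
  have hms (i j : Fin n) : star (m j i) = m i j := by
    rw [hm, hm, star_sum]
    exact Finset.sum_congr rfl fun k _ => by rw [star_mul, star_star]
  let X : CStarMatrix (Fin n) (Fin n) A := (L • m.map ⇑E - m : Matrix (Fin n) (Fin n) A)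
  have hXe (i j : Fin n) : X i j = L • E (m i j) - m i j := rfl
  have hXs' (i j : Fin n) : star (X j i) = X i j := by
    rw [hXe, hXe, star_sub, star_smul, ← hEs, hms]
    simp
  have hXs : IsSelfAdjoint X := by
    ext i j
    exact hXs' i j
  obtain ⟨Y, hY⟩ := fk_mat_pos X hXs (by
    intro y
    by_contra hneg
    set c : A := ∑ i, ∑ j, star (y i) * X i j * y j with hc
    have hcs : IsSelfAdjoint c := by
      rw [IsSelfAdjoint, hc, star_sum]
      simp only [star_sum, star_mul, star_star, hXs']
      rw [Finset.sum_comm]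
      simp only [mul_assoc]
    obtain ⟨H, _, _, _, p, hirr, hnd, w, hw⟩ := fk_exists_irrep c hcs hneg
    let ξ : Fin n → H := fun i => p (y i) w
    have h1 : ⟪w, p c w⟫_ℂ = ∑ i, ∑ j, ⟪ξ i, p (X i j) (ξ j)⟫_ℂ := by
      rw [hc]
      simp only [map_sum, sum_apply, inner_sum]
      refine Finset.sum_congr rfl fun i _ => Finset.sum_congr rfl fun j _ => ?_
      rw [map_mul, map_mul, fk_mul_apply, fk_mul_apply, fk_inner_star, star_star]
    have h2 (i j : Fin n) : ⟪ξ i, p (X i j) (ξ j)⟫_ℂ =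
        ∑ k, ((L : ℂ) * ⟪ξ i, p (E (star (x k i) * x k j)) (ξ j)⟫_ℂ
          - ⟪p (x k i) (ξ i), p (x k j) (ξ j)⟫_ℂ) := by
      rw [hXe, hm, map_sub, ← Complex.coe_smul, map_smul, sub_apply, smul_apply, inner_sub_right,
        inner_smul_right, Finset.sum_sub_distrib, ← Finset.mul_sum]
      simp only [map_sum, sum_apply, inner_sum]
      congr 1
      refine Finset.sum_congr rfl fun k _ => ?_
      rw [map_mul, fk_mul_apply, fk_inner_star, star_star]
    have h3 : ⟪w, p c w⟫_ℂ = ∑ k, ((L : ℂ) * (∑ i, ∑ j,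
        ⟪ξ i, p (E (star (x k i) * x k j)) (ξ j)⟫_ℂ) - ((‖∑ i, p (x k i) (ξ i)‖ ^ 2 : ℝ) : ℂ)) := by
      have e1 (k : Fin n) : ((‖∑ i, p (x k i) (ξ i)‖ ^ 2 : ℝ) : ℂ) =
          ∑ i, ∑ j, ⟪p (x k i) (ξ i), p (x k j) (ξ j)⟫_ℂ := by
        have := inner_self_eq_norm_sq_to_K (𝕜 := ℂ) (∑ i, p (x k i) (ξ i))
        push_cast
        refine Eq.trans this.symm ?_
        rw [sum_inner]
        exact Finset.sum_congr rfl fun i _ => inner_sum _ _ _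
      rw [h1, Finset.sum_congr rfl fun i _ => Finset.sum_congr rfl fun j _ => h2 i j,
        Finset.sum_congr rfl fun i _ => Finset.sum_comm, Finset.sum_comm]
      refine Finset.sum_congr rfl fun k _ => ?_
      rw [e1 k]
      simp only [Finset.mul_sum, Finset.sum_sub_distrib]
    rw [h3, Complex.re_sum] at hw
    refine absurd hw (not_lt.2 (Finset.sum_nonneg fun k _ => ?_))
    have h4 := fk_row p hirr hnd B E hrange hbimod γ hγ hE M hM (x k) ξ
    rw [Complex.sub_re, Complex.re_ofReal_mul, Complex.ofReal_re, sub_nonneg]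
    exact h4)
  exact ⟨Y, hY⟩

theorem finite_probabilistic_index_iff_finite_cp_index
    {A : Type*} [NonUnitalCStarAlgebra A] [PartialOrder A] [StarOrderedRing A]
    (B : NonUnitalStarSubalgebra ℂ A) (hB : IsClosed (B : Set A))
    (E : A →L[ℂ] A)
    (hrange : ∀ a : A, E a ∈ B)
    (hfix : ∀ b ∈ B, E b = b)
    (hpos : ∀ a : A, 0 ≤ a → 0 ≤ E a)
    (hbimod : ∀ b ∈ B, ∀ b' ∈ B, ∀ x : A, E (b * x * b') = b * E x * b') :
    (∃ γ : ℝ, 1 ≤ γ ∧ ∀ a : A, 0 ≤ a → a ≤ γ • E a) ↔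
    (∃ γ : ℝ, 1 ≤ γ ∧ ∀ (n : ℕ) (m : Matrix (Fin n) (Fin n) A),
      (∃ x : Matrix (Fin n) (Fin n) A, m = xᴴ * x) →
      ∃ y : Matrix (Fin n) (Fin n) A, γ • m.map ⇑E - m = yᴴ * y) := by

  constructor
  · rintro ⟨γ, hγ, hE⟩
    refine ⟨max 1 (2 * γ * ‖E‖) * γ, ?_, ?_⟩
    · exact one_le_mul_of_one_le_of_one_le (le_max_left _ _) hγ
    · rintro n _ ⟨x, rfl⟩
      exact fk_forward B E hrange hpos hbimod γ hγ hE _ (le_max_right _ _) n x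
  · rintro ⟨γ, hγ, h⟩
    refine ⟨γ, hγ, fun a ha => ?_⟩
    obtain ⟨s, hs⟩ := CStarAlgebra.nonneg_iff_eq_star_mul_self.1 ha
    obtain ⟨y, hy⟩ := h 1 (Matrix.of fun _ _ => a) ⟨Matrix.of fun _ _ => s, by
      ext i j
      rw [Matrix.mul_apply, Fin.sum_univ_one]
      exact hs⟩
    have h1 := congrFun (congrFun hy 0) 0
    rw [Matrix.mul_apply, Fin.sum_univ_one, Matrix.conjTranspose_apply] at h1
    rw [← sub_nonneg]
    have h2 : γ • E a - a = star (y 0 0) * y 0 0 := h1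
    rw [h2]
    exact star_mul_self_nonneg _
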